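/- Let Φ denote the standard normal cumulative distribution function, φ the standard normal density, and q = Φ⁻¹ the quantile function. Let C and N be finite sets, ι : C → N a map, and σ ∈ ℝ^N with σ_i ≥ 0 for all i. Fix α₀ ∈ (0,1) and suppose V : ℝ^C → ℝ is differentiable at b(α₀) ∈ ℝ^C, b(α₀)_c = q(α₀)·σ_{ι(c)}, with partial derivatives ∂V/∂b_c = λ_c, and suppose λ_c ≥ 0 for all c ∈ C. Then the derivative of α ↦ V((q(α)·σ_{ι(c)})_{c∈C}) at α₀ is nonnegative. -/

import Mathlib

open MeasureTheory

/-- The standard normal cumulative distribution function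
`Φ(x) = (2π)^{-1/2} ∫_{-∞}^x exp(-t²/2) dt`. -/
noncomputable def stdGaussianCDF (x : ℝ) : ℝ :=
  (Real.sqrt (2 * Real.pi))⁻¹ * ∫ t in Set.Iic x, Real.exp (-t ^ 2 / 2)

/-- The standard normal density `φ(x) = (2π)^{-1/2} exp(-x²/2)`. -/
noncomputable def stdGaussianPDF (x : ℝ) : ℝ :=
  (Real.sqrt (2 * Real.pi))⁻¹ * Real.exp (-x ^ 2 / 2)

theorem stdGaussianPDF_pos (x : ℝ) : 0 < stdGaussianPDF x := by
  unfold stdGaussianPDF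
  positivity

theorem integrable_exp_neg_sq_div_two : Integrable fun t : ℝ => Real.exp (-t ^ 2 / 2) := by
  refine (integrable_exp_neg_mul_sq (b := 1 / 2) (by norm_num)).congr (ae_of_all _ fun t => ?_)
  ring_nf

theorem hasDerivAt_stdGaussianCDF (x : ℝ) :
    HasDerivAt stdGaussianCDF (stdGaussianPDF x) x := by
  have hint := integrable_exp_neg_sq_div_two
  have hcont : Continuous fun t : ℝ => Real.exp (-t ^ 2 / 2) := by fun_prop
  have hsplit : stdGaussianCDF = fun y => (Real.sqrt (2 * Real.pi))⁻¹ *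
      ((∫ t in Set.Iic (0 : ℝ), Real.exp (-t ^ 2 / 2)) +
        ∫ t in (0 : ℝ)..y, Real.exp (-t ^ 2 / 2)) := by
    funext y
    rw [← intervalIntegral.integral_Iic_sub_Iic hint.integrableOn hint.integrableOn,
      add_sub_cancel]
    rfl
  rw [hsplit]
  exact ((hcont.integral_hasStrictDerivAt 0 x).hasDerivAt.const_add _).const_mul _

theorem strictMono_stdGaussianCDF : StrictMono stdGaussianCDF :=
  strictMono_of_hasDerivAt_pos hasDerivAt_stdGaussianCDF stdGaussianPDF_pos

/-- A right inverse, near `a`, of a strictly monotone function is continuous at `a`. -/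
theorem StrictMono.continuousAt_of_eventually_rightInverse {f g : ℝ → ℝ} (hf : StrictMono f)
    {a : ℝ} (hfg : ∀ᶠ y in nhds a, f (g y) = y) : ContinuousAt g a := by
  have ha : f (g a) = a := hfg.self_of_nhds
  refine tendsto_order.2 ⟨fun l hl => ?_, fun u hu => ?_⟩
  · filter_upwards [hfg, lt_mem_nhds (ha ▸ hf hl : f l < a)] with y hy hly
    exact hf.lt_iff_lt.1 (hy.symm ▸ hly)
  · filter_upwards [hfg, gt_mem_nhds (ha ▸ hf hu : a < f u)] with y hy hyu
    exact hf.lt_iff_lt.1 (hy.symm ▸ hyu)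

theorem hasDerivAt_stdGaussian_quantile {q : ℝ → ℝ}
    (hq : ∀ a ∈ Set.Ioo (0 : ℝ) 1, stdGaussianCDF (q a) = a)
    {a : ℝ} (ha : a ∈ Set.Ioo (0 : ℝ) 1) :
    HasDerivAt q (stdGaussianPDF (q a))⁻¹ a := by
  have hev : ∀ᶠ y in nhds a, stdGaussianCDF (q y) = y := by
    filter_upwards [isOpen_Ioo.mem_nhds ha] with y hy using hq y hy
  exact HasDerivAt.of_local_left_inverse
    (strictMono_stdGaussianCDF.continuousAt_of_eventually_rightInverse hev)
    (hasDerivAt_stdGaussianCDF (q a)) (stdGaussianPDF_pos (q a)).ne' hev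

/-- Chain-rule formula for the sensitivity of the optimal cost to the confidence level. -/
theorem hasDerivAt_optimalCost {C N : Type*} [Fintype C] [DecidableEq C]
    (ι : C → N) (σ : N → ℝ) {q : ℝ → ℝ}
    (hq : ∀ a ∈ Set.Ioo (0 : ℝ) 1, stdGaussianCDF (q a) = a)
    {α₀ : ℝ} (hα₀ : α₀ ∈ Set.Ioo (0 : ℝ) 1) {V : (C → ℝ) → ℝ} {lam : C → ℝ}
    (hV : DifferentiableAt ℝ V (fun c => q α₀ * σ (ι c)))
    (hpart : ∀ c : C, fderiv ℝ V (fun c => q α₀ * σ (ι c)) (Pi.single c 1) = lam c) :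
    HasDerivAt (fun α : ℝ => V (fun c => q α * σ (ι c)))
      ((stdGaussianPDF (q α₀))⁻¹ * ∑ c, lam c * σ (ι c)) α₀ := by
  have hmargin : HasDerivAt (fun α : ℝ => fun c => q α * σ (ι c))
      (fun c => (stdGaussianPDF (q α₀))⁻¹ * σ (ι c)) α₀ :=
    hasDerivAt_pi.2 fun c => (hasDerivAt_stdGaussian_quantile hq hα₀).mul_const _
  refine (hV.hasFDerivAt.comp_hasDerivAt α₀ hmargin).congr_deriv ?_
  rw [← ContinuousLinearMap.coe_coe, LinearMap.pi_apply_eq_sum_univ, Finset.mul_sum]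
  refine Finset.sum_congr rfl fun c _ => ?_
  have hsingle : (fun j => if c = j then (1 : ℝ) else 0) = Pi.single c 1 := by
    ext j
    simp [Pi.single_apply, eq_comm]
  rw [hsingle, ContinuousLinearMap.coe_coe, hpart, smul_eq_mul]
  ring

/-- **Robustness–efficiency tradeoff in the confidence level.** Under the setup of Theorem 2,
if the uncertainty levels satisfy `σ_i ≥ 0` and the dual multipliers satisfy `λ_c ≥ 0`, then
the map `α ↦ V((q(α)·σ_{ι(c)})_c)` is differentiable at `α₀` and its derivative there is
nonnegative: increasing the confidence level never decreases the optimal coordination cost. -/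
theorem alpha_sensitivity_nonneg
    {C N : Type*} [Fintype C] [Fintype N] [DecidableEq C] [DecidableEq N]
    (ι : C → N) (σ : N → ℝ) (hσ : ∀ i, 0 ≤ σ i)
    (q : ℝ → ℝ) (hq : ∀ a ∈ Set.Ioo (0:ℝ) 1, stdGaussianCDF (q a) = a)
    (α₀ : ℝ) (hα₀ : α₀ ∈ Set.Ioo (0:ℝ) 1)
    (V : (C → ℝ) → ℝ) (lam : C → ℝ)
    (hV : DifferentiableAt ℝ V (fun c => q α₀ * σ (ι c)))
    (hpart : ∀ c : C, fderiv ℝ V (fun c => q α₀ * σ (ι c)) (Pi.single c 1) = lam c)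
    (hlam : ∀ c, 0 ≤ lam c) :
    DifferentiableAt ℝ (fun α : ℝ => V (fun c => q α * σ (ι c))) α₀ ∧
    0 ≤ deriv (fun α : ℝ => V (fun c => q α * σ (ι c))) α₀ := by
  have hderiv := hasDerivAt_optimalCost ι σ hq hα₀ hV hpart
  refine ⟨hderiv.differentiableAt, ?_⟩
  rw [hderiv.deriv]
  exact mul_nonneg (inv_nonneg.2 (stdGaussianPDF_pos _).le)
    (Finset.sum_nonneg fun c _ => mul_nonneg (hlam c) (hσ _))
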